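/- Let k ≥ 2 be an integer and let G be a minimally (k,k)-edge-connected graph of size m ≥ (432k)², where m − k ≡ 0 (mod 2). Then ρ(G) ≤ (1/2)·√(2m + 2·√(2k² − 2km + m² − 8k + 4m + 8)), with equality if and only if G is isomorphic to K^{k−2}_{2,(m−k+2)/2}. -/

import Mathlib

open SimpleGraph

/-- The `l`-edge-connectivity of a graph: the minimum number of edges whose removal
leaves a graph with at least `l` connected components, if the graph has at least `l`
vertices; otherwise the number of vertices. -/
noncomputable def edgeConnL {V : Type*} (l : ℕ) (G : SimpleGraph V) : ℕ :=
  if l ≤ Nat.card V then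
    sInf {c : ℕ | ∃ F : Set (Sym2 V), F ⊆ G.edgeSet ∧ F.ncard = c ∧
      l ≤ Nat.card (G.deleteEdges F).ConnectedComponent}
  else Nat.card V

/-- A graph is minimally `(k,l)`-edge-connected if it is connected, its
`l`-edge-connectivity is at least `k`, and deleting any edge drops the
`l`-edge-connectivity below `k`. -/
def IsMinimallyKLEdgeConnected {V : Type*} (k l : ℕ) (G : SimpleGraph V) : Prop :=
  G.Connected ∧ k ≤ edgeConnL l G ∧
    ∀ e ∈ G.edgeSet, edgeConnL l (G.deleteEdges {e}) < k

/-- The real adjacency matrix of a simple graph. -/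
noncomputable def adjMat {V : Type*} (G : SimpleGraph V) : Matrix V V ℝ :=
  letI := Classical.decRel G.Adj
  G.adjMatrix ℝ

/-- The spectral radius of a graph: the largest (real) eigenvalue of its adjacency matrix. -/
noncomputable def specRad {V : Type*} [Fintype V] [DecidableEq V]
    (G : SimpleGraph V) : ℝ :=
  sSup (spectrum ℝ (adjMat G))

abbrev KbookV (p s : ℕ) : Type := (Unit ⊕ Unit) ⊕ (Fin s ⊕ Fin p)

/-- `K^{p}_{2,s}`: the graph obtained from the disjoint union of the star `K_{1,p}` and the
complete bipartite graph `K_{2,s}` by identifying the centre of the star with one of the two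
vertices of degree `s` of `K_{2,s}`.  Here `Sum.inl (Sum.inl _)` is the identified vertex,
`Sum.inl (Sum.inr _)` is the other vertex of the part of size two, `Fin s` is the part of
size `s` and `Fin p` are the pendant vertices. -/
def Kbook (p s : ℕ) : SimpleGraph (KbookV p s) :=
  SimpleGraph.fromRel (fun a b =>
    match a, b with
    | Sum.inl (Sum.inl _), Sum.inr _ => True
    | Sum.inl (Sum.inr _), Sum.inr (Sum.inl _) => True
    | _, _ => False)

section Components

variable {V : Type*}

lemma SimpleGraph.Reachable.cases_deleteEdge {G : SimpleGraph V} {u v : V} (a b : V)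
    (h : G.Reachable u v) :
    (G.deleteEdges {s(a, b)}).Reachable u v ∨
      ((G.deleteEdges {s(a, b)}).Reachable u a ∧ (G.deleteEdges {s(a, b)}).Reachable b v) ∨
      ((G.deleteEdges {s(a, b)}).Reachable u b ∧ (G.deleteEdges {s(a, b)}).Reachable a v) := by
  obtain ⟨p⟩ := h
  induction p with
  | nil => exact Or.inl (Reachable.refl _)
  | @cons u u' v h p ih =>
    by_cases he : s(u, u') = s(a, b)
    · rcases Sym2.eq_iff.1 he with ⟨rfl, rfl⟩ | ⟨rfl, rfl⟩
      · rcases ih with ih | ⟨_, ih⟩ | ⟨_, ih⟩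
        · exact Or.inr (Or.inl ⟨Reachable.refl _, ih⟩)
        · exact Or.inr (Or.inl ⟨Reachable.refl _, ih⟩)
        · exact Or.inl ih
      · rcases ih with ih | ⟨_, ih⟩ | ⟨_, ih⟩
        · exact Or.inr (Or.inr ⟨Reachable.refl _, ih⟩)
        · exact Or.inl ih
        · exact Or.inr (Or.inr ⟨Reachable.refl _, ih⟩)
    · have hr : (G.deleteEdges {s(a, b)}).Reachable u u' :=
        Adj.reachable (by rw [deleteEdges_adj]; exact ⟨h, he⟩)
      rcases ih with ih | ⟨ih, ih'⟩ | ⟨ih, ih'⟩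
      · exact Or.inl (hr.trans ih)
      · exact Or.inr (Or.inl ⟨hr.trans ih, ih'⟩)
      · exact Or.inr (Or.inr ⟨hr.trans ih, ih'⟩)

lemma card_components_deleteEdge_le [Finite V] (G : SimpleGraph V) (e : Sym2 V) :
    Nat.card (G.deleteEdges {e}).ConnectedComponent ≤ Nat.card G.ConnectedComponent + 1 := by
  classical
  induction e using Sym2.ind with
  | _ a b =>
  rw [← Finite.card_option]
  let f : (G.deleteEdges {s(a, b)}).ConnectedComponent → Option G.ConnectedComponent := fun c =>
    if c = connectedComponentMk _ a then none
    else some (c.map (Hom.ofLE (deleteEdges_le _)))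
  refine Nat.card_le_card_of_injective f ?_
  intro c d
  induction c using ConnectedComponent.ind with
  | _ u =>
  induction d using ConnectedComponent.ind with
  | _ v =>
  intro h
  simp only [f] at h
  split_ifs at h with h1 h2 h2
  · rw [h1, h2]
  · simp only [ConnectedComponent.map_mk, Hom.coe_ofLE, id, Option.some.injEq,
      ConnectedComponent.eq] at h
    rw [ConnectedComponent.eq] at h1 h2 ⊢
    rcases h.cases_deleteEdge a b with h | ⟨h, _⟩ | ⟨_, h⟩
    · exact h
    · exact absurd h h1
    · exact absurd h.symm h2

lemma card_components_deleteEdge_le_of_reachable [Finite V] (G : SimpleGraph V) (a b : V)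
    (hab : (G.deleteEdges {s(a, b)}).Reachable a b) :
    Nat.card (G.deleteEdges {s(a, b)}).ConnectedComponent ≤ Nat.card G.ConnectedComponent := by
  refine Nat.card_le_card_of_injective
    (fun c => c.map (Hom.ofLE (deleteEdges_le _))) ?_
  intro c d
  induction c using ConnectedComponent.ind with
  | _ u =>
  induction d using ConnectedComponent.ind with
  | _ v =>
  intro h
  simp only [ConnectedComponent.map_mk, Hom.coe_ofLE, id, ConnectedComponent.eq] at h ⊢
  rcases h.cases_deleteEdge a b with h | ⟨h, h'⟩ | ⟨h, h'⟩
  · exact h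
  · exact h.trans (hab.trans h')
  · exact h.trans (hab.symm.trans h')

lemma card_components_deleteEdges_le [Finite V] (G : SimpleGraph V) (F : Set (Sym2 V)) :
    Nat.card (G.deleteEdges F).ConnectedComponent ≤
      Nat.card G.ConnectedComponent + F.ncard := by
  induction F, F.toFinite using Set.Finite.induction_on with
  | empty => simp
  | @insert e F he hF ih =>
    rw [Set.ncard_insert_of_notMem he hF, ← Set.union_singleton, ← deleteEdges_deleteEdges]
    have := card_components_deleteEdge_le (G.deleteEdges F) e
    omega

lemma SimpleGraph.Connected.card_components_le_one {G : SimpleGraph V} (h : G.Preconnected) :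
    Nat.card G.ConnectedComponent ≤ 1 := by
  have := h.subsingleton_connectedComponent
  exact Finite.card_le_one_iff_subsingleton.2 this

/-- If every edge of `F` is a bridge of `H` which does not separate `u` from `v`, then `F` does
not separate `u` from `v`. -/
lemma SimpleGraph.Reachable.deleteEdges_of_bridges [Finite V] {H : SimpleGraph V} {u v : V}
    (h : H.Reachable u v) (F : Set (Sym2 V))
    (hF : ∀ a b, s(a, b) ∈ F → ¬ (H.deleteEdges {s(a, b)}).Reachable a b)
    (huv : ∀ f ∈ F, (H.deleteEdges {f}).Reachable u v) :
    (H.deleteEdges F).Reachable u v := by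
  induction F, F.toFinite using Set.Finite.induction_on with
  | empty => simpa using h
  | @insert e F he _ ih =>
    have ih := ih (fun a b hab => hF a b (Set.mem_insert_of_mem _ hab))
      (fun f hf => huv f (Set.mem_insert_of_mem _ hf))
    induction e using Sym2.ind with
    | _ a b =>
    rw [← Set.union_singleton, ← deleteEdges_deleteEdges]
    have hle : (H.deleteEdges F).deleteEdges {s(a, b)} ≤ H.deleteEdges {s(a, b)} :=
      deleteEdges_mono (deleteEdges_le _)
    have h1 := hF a b (Set.mem_insert _ _)
    have h2 := huv _ (Set.mem_insert _ _)
    rcases ih.cases_deleteEdge a b with h | ⟨h, h'⟩ | ⟨h, h'⟩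
    · exact h
    · exact absurd ((h.mono hle).symm.trans (h2.trans (h'.mono hle).symm)) h1
    · exact absurd ((h'.mono hle).trans (h2.symm.trans (h.mono hle))) h1

end Components

section Minimality

variable {V : Type*} {G : SimpleGraph V} {k : ℕ}

lemma IsMinimallyKLEdgeConnected.le_card (hG : IsMinimallyKLEdgeConnected k k G) :
    k ≤ Nat.card V := by
  by_contra h
  have := hG.2.1
  rw [edgeConnL, if_neg h] at this
  exact h this

lemma IsMinimallyKLEdgeConnected.le_ncard (hG : IsMinimallyKLEdgeConnected k k G)
    {F : Set (Sym2 V)} (hF : F ⊆ G.edgeSet)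
    (h : k ≤ Nat.card (G.deleteEdges F).ConnectedComponent) : k ≤ F.ncard := by
  have := hG.2.1
  rw [edgeConnL, if_pos hG.le_card] at this
  exact this.trans (Nat.sInf_le ⟨F, hF, rfl, h⟩)

variable [Finite V]

lemma IsMinimallyKLEdgeConnected.exists_cut (hG : IsMinimallyKLEdgeConnected k k G)
    {e : Sym2 V} (he : e ∈ G.edgeSet) :
    ∃ F ⊆ (G.deleteEdges {e}).edgeSet, F.ncard < k ∧
      k ≤ Nat.card ((G.deleteEdges {e}).deleteEdges F).ConnectedComponent := by
  have h := hG.2.2 e he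
  rw [edgeConnL, if_pos hG.le_card] at h
  have hne : {c : ℕ | ∃ F : Set (Sym2 V), F ⊆ (G.deleteEdges {e}).edgeSet ∧ F.ncard = c ∧
      k ≤ Nat.card ((G.deleteEdges {e}).deleteEdges F).ConnectedComponent}.Nonempty := by
    refine ⟨_, _, subset_rfl, rfl, hG.le_card.trans ?_⟩
    refine Nat.card_le_card_of_injective (fun v => connectedComponentMk _ v) ?_
    intro u v huv
    have huv := ConnectedComponent.eq.1 huv
    rwa [deleteEdges_eq_bot.2 subset_rfl, reachable_bot] at huv
  obtain ⟨F, hF, hc, hk⟩ := Nat.sInf_mem hne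
  exact ⟨F, hF, hc ▸ h, hk⟩

/-- Deleting a non-bridge `e` creates at least `k - 1` bridges. -/
lemma IsMinimallyKLEdgeConnected.exists_bridges (hG : IsMinimallyKLEdgeConnected k k G)
    {e : Sym2 V} (he : e ∈ G.edgeSet) (hc : (G.deleteEdges {e}).Preconnected) :
    ∃ F ⊆ (G.deleteEdges {e}).edgeSet, F.ncard + 1 = k ∧
      k ≤ Nat.card ((G.deleteEdges {e}).deleteEdges F).ConnectedComponent ∧
      ∀ a b, s(a, b) ∈ F → ¬ ((G.deleteEdges {e}).deleteEdges {s(a, b)}).Reachable a b := by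
  obtain ⟨F, hF, hlt, hk⟩ := hG.exists_cut he
  have h1 := SimpleGraph.Connected.card_components_le_one hc
  have h2 := card_components_deleteEdges_le (G.deleteEdges {e}) F
  refine ⟨F, hF, by omega, hk, fun a b hab hr => ?_⟩
  have h3 := card_components_deleteEdge_le_of_reachable _ a b hr
  have h4 := card_components_deleteEdges_le
    ((G.deleteEdges {e}).deleteEdges {s(a, b)}) (F \ {s(a, b)})
  rw [deleteEdges_deleteEdges, Set.union_sdiff_cancel (Set.singleton_subset_iff.2 hab)] at h4
  have h5 := Set.ncard_sdiff_singleton_add_one hab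
  omega

/-- The ends of every edge are separated by the deletion of at most two edges. -/
lemma IsMinimallyKLEdgeConnected.exists_not_reachable
    (hG : IsMinimallyKLEdgeConnected k k G) {u v : V} (huv : G.Adj u v) :
    ∃ f, ¬ (G.deleteEdges {s(u, v), f}).Reachable u v := by
  by_cases hr : (G.deleteEdges {s(u, v)}).Reachable u v
  · have hc : (G.deleteEdges {s(u, v)}).Preconnected := by
      intro x y
      rcases (hG.1.preconnected x y).cases_deleteEdge u v with h | ⟨h, h'⟩ | ⟨h, h'⟩
      · exact h
      · exact h.trans (hr.trans h')
      · exact h.trans (hr.symm.trans h')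
    obtain ⟨F, hF, hcard, hcomp, hbr⟩ := hG.exists_bridges (e := s(u, v)) huv hc
    by_contra! hcon
    have h1 := hr.deleteEdges_of_bridges F hbr (fun f _ => by
      have := hcon f
      rwa [← Set.singleton_union, ← deleteEdges_deleteEdges] at this)
    rw [deleteEdges_deleteEdges, Set.union_comm, ← deleteEdges_deleteEdges] at h1 hcomp
    have h2 := card_components_deleteEdge_le_of_reachable (G.deleteEdges F) u v h1
    have h3 := hG.le_ncard (F := F)
      (hF.trans (edgeSet_mono (deleteEdges_le _))) (hcomp.trans h2)
    omega
  · exact ⟨s(u, v), by simpa using hr⟩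

lemma IsMinimallyKLEdgeConnected.ncard_leaves (hk : 2 ≤ k)
    (hG : IsMinimallyKLEdgeConnected k k G) (u : V) (T : Set V)
    (hT : ∀ a ∈ T, ∀ b, G.Adj a b ↔ b = u) : T.ncard + 2 ≤ k := by
  by_contra! hlt
  obtain ⟨T', hT'T, hT'c⟩ : ∃ T' ⊆ T, T'.ncard = k - 1 :=
    Set.exists_subset_card_eq (by omega)
  have hu : u ∉ T' := fun h => G.irrefl ((hT u (hT'T h) u).2 rfl)
  let F : Set (Sym2 V) := (fun a => s(a, u)) '' T'
  have hF : F ⊆ G.edgeSet := by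
    rintro _ ⟨a, ha, rfl⟩
    exact (hT a (hT'T ha) u).2 rfl
  have hFc : F.ncard ≤ k - 1 := hT'c ▸ Set.ncard_image_le
  have hiso : ∀ a ∈ T', ∀ b, (G.deleteEdges F).Reachable a b → a = b := by
    rintro a ha b ⟨p⟩
    cases p with
    | nil => rfl
    | cons h _ =>
      rw [deleteEdges_adj] at h
      obtain rfl := (hT a (hT'T ha) _).1 h.1
      exact absurd ⟨a, ha, rfl⟩ h.2
  have hcomp : k ≤ Nat.card (G.deleteEdges F).ConnectedComponent := by
    have h1 : (insert u T').ncard = k := by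
      rw [Set.ncard_insert_of_notMem hu]; omega
    rw [← h1, ← Nat.card_coe_set_eq]
    refine Nat.card_le_card_of_injective
      (fun v : (insert u T' : Set V) => connectedComponentMk _ v.1) ?_
    rintro ⟨a, ha⟩ ⟨b, hb⟩ hab
    have hab := ConnectedComponent.eq.1 hab
    simp only [Subtype.mk.injEq]
    rcases ha with rfl | ha
    · rcases hb with rfl | hb
      · rfl
      · exact (hiso b hb _ hab.symm).symm
    · exact hiso a ha _ hab
  have := hG.le_ncard hF hcomp
  omega

end Minimality

section Perron

variable {V : Type*}

/-- The entries of the adjacency matrix, as a plain function. -/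
noncomputable def adjVal (G : SimpleGraph V) (a b : V) : ℝ := adjMat G a b

lemma adjVal_of_adj {G : SimpleGraph V} {a b : V} (h : G.Adj a b) : adjVal G a b = 1 := by
  simp [adjVal, adjMat, h]

lemma adjVal_of_not_adj {G : SimpleGraph V} {a b : V} (h : ¬ G.Adj a b) : adjVal G a b = 0 := by
  simp [adjVal, adjMat, h]

lemma adjVal_nonneg (G : SimpleGraph V) (a b : V) : 0 ≤ adjVal G a b := by
  by_cases h : G.Adj a b
  · simp [adjVal_of_adj h]
  · simp [adjVal_of_not_adj h]

lemma adjVal_le_one (G : SimpleGraph V) (a b : V) : adjVal G a b ≤ 1 := by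
  by_cases h : G.Adj a b
  · simp [adjVal_of_adj h]
  · simp [adjVal_of_not_adj h]

lemma adjVal_comm (G : SimpleGraph V) (a b : V) : adjVal G a b = adjVal G b a := by
  by_cases h : G.Adj a b
  · rw [adjVal_of_adj h, adjVal_of_adj h.symm]
  · rw [adjVal_of_not_adj h, adjVal_of_not_adj (fun h' => h h'.symm)]

lemma adjMat_isHermitian (G : SimpleGraph V) : (adjMat G).IsHermitian := by
  ext a b
  exact adjVal_comm G b a

variable [Fintype V] [DecidableEq V]

lemma le_specRad {G : SimpleGraph V} {μ : ℝ} (h : μ ∈ spectrum ℝ (adjMat G)) : μ ≤ specRad G :=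
  le_csSup (Matrix.finite_real_spectrum).bddAbove h

lemma mem_spectrum_of_mulVec_eq {A : Matrix V V ℝ} {μ : ℝ} {x : V → ℝ} (hx : x ≠ 0)
    (h : A.mulVec x = μ • x) : μ ∈ spectrum ℝ A := by
  rw [← Matrix.spectrum_toLin']
  refine Module.End.HasEigenvalue.mem_spectrum
    (Module.End.hasEigenvalue_of_hasEigenvector (x := x) ⟨?_, hx⟩)
  rw [Module.End.mem_eigenspace_iff, Matrix.toLin'_apply, h]

/-- The spectral radius has a nonnegative eigenvector whose largest entry equals `1`. -/
lemma exists_perron_vector [Nonempty V] (G : SimpleGraph V) :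
    ∃ x : V → ℝ, (∀ a, 0 ≤ x a) ∧ (∀ a, x a ≤ 1) ∧ (∃ u, x u = 1) ∧
      ∀ a, ∑ b, adjVal G a b * x b = specRad G * x a := by
  set A := adjMat G with hA
  set ρ := specRad G with hρ
  have hne : (spectrum ℝ A).Nonempty :=
    ⟨_, (adjMat_isHermitian G).eigenvalues_mem_spectrum_real (Classical.arbitrary V)⟩
  have hmem : ρ ∈ spectrum ℝ A := hne.csSup_mem Matrix.finite_real_spectrum
  rw [← Matrix.spectrum_toLin', ← Module.End.hasEigenvalue_iff_mem_spectrum] at hmem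
  obtain ⟨v, hv⟩ := hmem.exists_hasEigenvector
  have hv0 : v ≠ 0 := hv.2
  have hAv : A.mulVec v = ρ • v := by
    simpa [Module.End.mem_eigenspace_iff] using hv.1
  have hpsd : (algebraMap ℝ (Matrix V V ℝ) ρ - A).PosSemidef := by
    rw [Matrix.posSemidef_iff_isHermitian_and_spectrum_nonneg]
    refine ⟨Matrix.IsHermitian.sub ?_ (adjMat_isHermitian G), ?_⟩
    · rw [Algebra.algebraMap_eq_smul_one, Matrix.IsHermitian]
      simp
    · intro μ hμ
      rw [← spectrum.singleton_sub_eq] at hμ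
      obtain ⟨_, rfl, ν, hν, rfl⟩ := Set.mem_sub.1 hμ
      simpa using le_specRad hν
  have hM : ∀ x : V → ℝ, (algebraMap ℝ (Matrix V V ℝ) ρ - A).mulVec x = ρ • x - A.mulVec x := by
    intro x
    rw [Matrix.sub_mulVec, Algebra.algebraMap_eq_smul_one, Matrix.smul_mulVec, Matrix.one_mulVec]
  have hz := (hpsd.dotProduct_mulVec_zero_iff (fun a => |v a|)).1 (le_antisymm ?_
    (hpsd.dotProduct_mulVec_nonneg _))
  · rw [hM, sub_eq_zero] at hz
    obtain ⟨u, hu⟩ := Finite.exists_max (fun a => |v a|)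
    have hupos : 0 < |v u| := by
      obtain ⟨a, ha⟩ := Function.ne_iff.1 hv0
      exact (abs_pos.2 ha).trans_le (hu a)
    refine ⟨fun a => |v a| / |v u|, fun a => by positivity,
      fun a => (div_le_one hupos).2 (hu a), ⟨u, div_self hupos.ne'⟩, fun a => ?_⟩
    have := congrFun hz a
    simp only [Pi.smul_apply, smul_eq_mul, Matrix.mulVec, dotProduct] at this
    simp_rw [mul_div_assoc', ← Finset.sum_div]
    exact congrArg (· / |v u|) this.symm
  · have h0 : ∑ a, v a * (ρ * v a - ∑ b, A a b * v b) = 0 := by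
      refine Finset.sum_eq_zero fun a _ => ?_
      have := congrFun hAv a
      simp only [Pi.smul_apply, smul_eq_mul, Matrix.mulVec, dotProduct] at this
      rw [this, sub_self, mul_zero]
    rw [← h0, hM]
    simp only [dotProduct, Matrix.mulVec, Pi.sub_apply, Pi.smul_apply, smul_eq_mul, Pi.star_apply,
      star_trivial]
    refine Finset.sum_le_sum fun a _ => ?_
    rw [mul_sub, mul_sub, Finset.mul_sum, Finset.mul_sum]
    refine sub_le_sub (le_of_eq ?_) (Finset.sum_le_sum fun b _ => ?_)
    · rw [mul_left_comm, abs_mul_abs_self, mul_left_comm]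
    · rw [mul_left_comm, mul_left_comm |v a|, ← abs_mul]
      exact mul_le_mul_of_nonneg_left (le_abs_self _) (adjVal_nonneg G a b)

end Perron

section Cuts

variable {V : Type*} {G : SimpleGraph V}

/-- The number of neighbours of `a` in `L`. -/
noncomputable def nbrCount (G : SimpleGraph V) (L : Finset V) (a : V) : ℝ :=
  ∑ c ∈ L, adjVal G a c

lemma nbrCount_nonneg (L : Finset V) (a : V) : 0 ≤ nbrCount G L a :=
  Finset.sum_nonneg fun _ _ => adjVal_nonneg _ _ _

lemma nbrCount_eq_zero_or_one_le (L : Finset V) (a : V) :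
    nbrCount G L a = 0 ∨ 1 ≤ nbrCount G L a ∧ ∃ c ∈ L, G.Adj a c := by
  by_cases h : ∃ c ∈ L, G.Adj a c
  · obtain ⟨c, hc, hac⟩ := h
    refine Or.inr ⟨?_, c, hc, hac⟩
    rw [← adjVal_of_adj hac]
    exact Finset.single_le_sum (fun c _ => adjVal_nonneg G a c) hc
  · push Not at h
    exact Or.inl (Finset.sum_eq_zero fun c hc => adjVal_of_not_adj (h c hc))

variable [Fintype V]

lemma sum_adjVal (m : ℕ) (hm : G.edgeSet.ncard = m) : ∑ a, ∑ b, adjVal G a b = 2 * m := by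
  classical
  have h := G.sum_degrees_eq_twice_card_edges
  rw [← hm, ← Set.ncard_coe_finset G.edgeFinset, coe_edgeFinset] at *
  rw [← Nat.cast_two, ← Nat.cast_mul, ← h, Nat.cast_sum]
  refine Finset.sum_congr rfl fun a _ => ?_
  rw [← card_neighborFinset_eq_degree, neighborFinset_eq_filter, Finset.card_filter]
  push_cast
  exact Finset.sum_congr rfl fun b _ => by simp [adjVal, adjMat, adjMatrix_apply]

variable [DecidableEq V]

/-- The number of edges of `G` between `S` and its complement. -/
noncomputable def cutSize (G : SimpleGraph V) (S : Finset V) : ℝ :=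
  ∑ a ∈ S, ∑ b ∈ Sᶜ, adjVal G a b

/-- Two vertices are equivalent if no cut with at most two edges separates them. -/
def TwoCutEquiv (G : SimpleGraph V) (a b : V) : Prop :=
  ∀ S : Finset V, cutSize G S ≤ 2 → (a ∈ S ↔ b ∈ S)

lemma TwoCutEquiv.symm {a b : V} (h : TwoCutEquiv G a b) : TwoCutEquiv G b a :=
  fun S hS => (h S hS).symm

lemma TwoCutEquiv.trans {a b c : V} (h : TwoCutEquiv G a b) (h' : TwoCutEquiv G b c) :
    TwoCutEquiv G a c :=
  fun S hS => (h S hS).trans (h' S hS)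

lemma cutSize_compl (S : Finset V) : cutSize G Sᶜ = cutSize G S := by
  rw [cutSize, cutSize, compl_compl, Finset.sum_comm]
  simp_rw [adjVal_comm G]

lemma sum_adjVal_le_cutSize {S : Finset V} {a : V} (ha : a ∈ S) :
    ∑ b ∈ Sᶜ, adjVal G a b ≤ cutSize G S :=
  Finset.single_le_sum (f := fun a => ∑ b ∈ Sᶜ, adjVal G a b)
    (fun _ _ => Finset.sum_nonneg fun _ _ => adjVal_nonneg _ _ _) ha

lemma exists_cutSize_le_two_of_not_reachable {u v : V} {e f : Sym2 V}
    (h : ¬ (G.deleteEdges {e, f}).Reachable u v) :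
    ∃ S : Finset V, u ∈ S ∧ v ∉ S ∧ cutSize G S ≤ 2 := by
  classical
  let S : Finset V := Finset.univ.filter fun a => (G.deleteEdges {e, f}).Reachable u a
  refine ⟨S, by simp [S], by simpa [S] using h, ?_⟩
  have h1 : cutSize G S = (((S ×ˢ Sᶜ).filter fun p => G.Adj p.1 p.2).card : ℝ) := by
    rw [cutSize, ← Finset.sum_product', Finset.card_filter]
    push_cast
    refine Finset.sum_congr rfl fun p _ => ?_
    by_cases hp : G.Adj p.1 p.2
    · simp [hp, adjVal_of_adj hp]
    · simp [hp, adjVal_of_not_adj hp]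
  have h2 : ((S ×ˢ Sᶜ).filter fun p => G.Adj p.1 p.2).card ≤ ({e, f} : Finset (Sym2 V)).card := by
    refine Finset.card_le_card_of_injOn (fun p => s(p.1, p.2)) ?_ ?_
    · rintro ⟨a, b⟩ hp
      simp only [Finset.coe_filter, Finset.mem_product, Finset.mem_compl, Set.mem_ofPred_eq, S,
        Finset.mem_filter, Finset.mem_univ, true_and] at hp
      by_contra hcon
      refine hp.1.2 (hp.1.1.trans (Adj.reachable ?_))
      rw [deleteEdges_adj]
      exact ⟨hp.2, by simpa using hcon⟩
    · rintro ⟨a, b⟩ hp ⟨c, d⟩ hq heq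
      simp only [Finset.coe_filter, Finset.mem_product, Finset.mem_compl, Set.mem_ofPred_eq]
        at hp hq
      rcases Sym2.eq_iff.1 heq with ⟨rfl, rfl⟩ | ⟨rfl, rfl⟩
      · rfl
      · exact absurd hp.1.1 hq.1.2
  rw [h1]
  exact_mod_cast h2.trans Finset.card_le_two

lemma sum_adjVal_mul_le_two_of_not_twoCutEquiv {a c : V} (h : ¬ TwoCutEquiv G a c) :
    ∑ b, adjVal G a b * adjVal G b c ≤ 2 := by
  have key : ∀ (S : Finset V) (a c : V), cutSize G S ≤ 2 → a ∈ S → c ∉ S →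
      ∑ b, adjVal G a b * adjVal G b c ≤ 2 := by
    intro S a c hS ha hc
    refine le_trans ?_ hS
    rw [cutSize, ← Finset.sum_add_sum_compl S, ← Finset.add_sum_erase S _ ha,
      ← Finset.add_sum_erase S _ ha]
    rw [adjVal_of_not_adj (G.irrefl (v := a)), zero_mul, zero_add, add_comm]
    refine add_le_add (Finset.sum_le_sum fun b _ => ?_) (Finset.sum_le_sum fun b _ => ?_)
    · exact mul_le_of_le_one_right (adjVal_nonneg _ _ _) (adjVal_le_one _ _ _)
    · calc adjVal G a b * adjVal G b c ≤ adjVal G b c :=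
            mul_le_of_le_one_left (adjVal_nonneg _ _ _) (adjVal_le_one _ _ _)
        _ ≤ ∑ j ∈ Sᶜ, adjVal G b j :=
            Finset.single_le_sum (fun j _ => adjVal_nonneg G b j) (Finset.mem_compl.2 hc)
  simp only [TwoCutEquiv, not_forall, not_iff] at h
  obtain ⟨S, hS, h⟩ := h
  by_cases ha : a ∈ S
  · exact key S a c hS ha (fun hc => h.2 hc ha)
  · refine key Sᶜ a c (by rwa [cutSize_compl]) (Finset.mem_compl.2 ha) ?_
    simpa using h.1 ha

/-- The ends of every edge are separated by a cut with at most two edges. -/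
def TwoCutEdges (G : SimpleGraph V) : Prop :=
  ∀ a b, G.Adj a b → ¬ TwoCutEquiv G a b

lemma nbrCount_le_two (hG : TwoCutEdges G) {L : Finset V}
    (hL : ∀ c ∈ L, ∀ c' ∈ L, TwoCutEquiv G c c') (a : V) : nbrCount G L a ≤ 2 := by
  rcases nbrCount_eq_zero_or_one_le (G := G) L a with h | ⟨_, c, hc, hac⟩
  · rw [h]; norm_num
  · have key : ∀ S : Finset V, cutSize G S ≤ 2 → a ∈ S → c ∉ S → nbrCount G L a ≤ 2 := by
      intro S hS ha hcS
      refine le_trans ?_ ((sum_adjVal_le_cutSize ha).trans hS)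
      refine Finset.sum_le_sum_of_subset_of_nonneg (fun d hd => ?_)
        (fun _ _ _ => adjVal_nonneg _ _ _)
      rw [Finset.mem_compl, ← hL c hc d hd S hS]
      exact hcS
    have h := hG a c hac
    simp only [TwoCutEquiv, not_forall, not_iff] at h
    obtain ⟨S, hS, h⟩ := h
    by_cases ha : a ∈ S
    · exact key S hS ha (fun hc => h.2 hc ha)
    · exact key Sᶜ (by rwa [cutSize_compl]) (Finset.mem_compl.2 ha) (by simpa using h.1 ha)

end Cuts

section Walks

variable {V : Type*} [Fintype V] {G : SimpleGraph V} {x : V → ℝ} {ρ : ℝ}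

lemma sum_nbrCount_mul (hx : ∀ a, ∑ b, adjVal G a b * x b = ρ * x a) (L : Finset V) :
    ∑ a, nbrCount G L a * x a = ρ * ∑ c ∈ L, x c := by
  simp_rw [nbrCount, Finset.sum_mul]
  rw [Finset.sum_comm, Finset.mul_sum]
  refine Finset.sum_congr rfl fun c _ => ?_
  rw [← hx c]
  exact Finset.sum_congr rfl fun a _ => by rw [adjVal_comm]

lemma sum_sum_nbrCount_mul (hx : ∀ a, ∑ b, adjVal G a b * x b = ρ * x a) (L : Finset V) :
    ∑ a, ∑ b, adjVal G a b * (nbrCount G L a * x b) = ρ ^ 2 * ∑ c ∈ L, x c := by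
  rw [pow_two, mul_assoc, ← sum_nbrCount_mul hx, Finset.mul_sum]
  refine Finset.sum_congr rfl fun a _ => ?_
  rw [mul_left_comm, ← hx a, Finset.mul_sum]
  exact Finset.sum_congr rfl fun b _ => by ring

lemma sum_sum_swap (f : V → V → ℝ) :
    ∑ a, ∑ b, adjVal G a b * f b a = ∑ a, ∑ b, adjVal G a b * f a b := by
  rw [Finset.sum_comm]
  simp_rw [adjVal_comm G]

lemma sum_sum_symm (f : V → V → ℝ) :
    ∑ a, ∑ b, adjVal G a b * (f a b + f b a) = 2 * ∑ a, ∑ b, adjVal G a b * f a b := by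
  simp_rw [mul_add, Finset.sum_add_distrib]
  rw [sum_sum_swap]
  ring

variable [DecidableEq V]

lemma sum_sum_nbrCount_mul_nbrCount_le (hG : TwoCutEdges G) (hx0 : ∀ a, 0 ≤ x a)
    (hx : ∀ a, ∑ b, adjVal G a b * x b = ρ * x a) {L : Finset V}
    (hL : ∀ c ∈ L, ∀ c' ∈ L, TwoCutEquiv G c c') :
    ∑ a, ∑ b, adjVal G a b * (nbrCount G L a * nbrCount G L b * x a) ≤
      2 * L.card * (ρ * ∑ c ∈ L, x c) := by
  rw [← sum_nbrCount_mul hx, Finset.mul_sum]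
  refine Finset.sum_le_sum fun a _ => ?_
  have h : ∑ b, adjVal G a b * (nbrCount G L a * nbrCount G L b * x a) =
      (∑ b, adjVal G a b * nbrCount G L b) * (nbrCount G L a * x a) := by
    rw [Finset.sum_mul]
    exact Finset.sum_congr rfl fun b _ => by ring
  rw [h]
  rcases nbrCount_eq_zero_or_one_le (G := G) L a with h0 | ⟨_, c, hc, hac⟩
  · simp [h0]
  · refine mul_le_mul_of_nonneg_right ?_ (mul_nonneg (nbrCount_nonneg _ _) (hx0 a))
    simp_rw [nbrCount, Finset.mul_sum]
    rw [Finset.sum_comm, mul_comm, ← nsmul_eq_mul]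
    refine Finset.sum_le_card_nsmul _ _ _ fun d hd => ?_
    refine sum_adjVal_mul_le_two_of_not_twoCutEquiv fun had => ?_
    exact hG a c hac (had.trans (hL d hd c hc))

/-- Bounding the two-walks ending in a class `L` of equivalent vertices edge by edge. -/
lemma walk_bound (hG : TwoCutEdges G) (hx0 : ∀ a, 0 ≤ x a)
    (hx : ∀ a, ∑ b, adjVal G a b * x b = ρ * x a) {L : Finset V}
    (hL : ∀ c ∈ L, ∀ c' ∈ L, TwoCutEquiv G c c') (h : V → V → ℝ)
    (hh : ∀ a b, G.Adj a b → nbrCount G L a * x b + nbrCount G L b * x a ≤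
      h a b + h b a + nbrCount G L a * nbrCount G L b * (x a + x b)) :
    ρ ^ 2 * ∑ c ∈ L, x c ≤
      ∑ a, ∑ b, adjVal G a b * h a b + 2 * L.card * (ρ * ∑ c ∈ L, x c) := by
  have h1 := sum_sum_nbrCount_mul hx L
  have h2 := sum_sum_nbrCount_mul_nbrCount_le hG hx0 hx hL
  have h3 : ∑ a, ∑ b, adjVal G a b * (nbrCount G L a * x b + nbrCount G L b * x a) ≤
      ∑ a, ∑ b, adjVal G a b * ((h a b + nbrCount G L a * nbrCount G L b * x a) +
        (h b a + nbrCount G L b * nbrCount G L a * x b)) := by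
    refine Finset.sum_le_sum fun a _ => Finset.sum_le_sum fun b _ => ?_
    by_cases hab : G.Adj a b
    · rw [adjVal_of_adj hab]
      linarith [hh a b hab]
    · rw [adjVal_of_not_adj hab, zero_mul, zero_mul]
  rw [sum_sum_symm (fun a b => nbrCount G L a * x b),
    sum_sum_symm (fun a b => h a b + nbrCount G L a * nbrCount G L b * x a)] at h3
  simp_rw [mul_add, Finset.sum_add_distrib] at h3
  linarith

end Walks

section Structure

variable {V : Type*} {G : SimpleGraph V} {x : V → ℝ} {ρ m k : ℝ}

lemma nbrCount_singleton (u a : V) : nbrCount G {u} a = adjVal G a u := by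
  simp [nbrCount]

lemma nbrCount_pair [DecidableEq V] {u w : V} (huw : w ≠ u) (a : V) :
    nbrCount G {u, w} a = adjVal G a u + adjVal G a w :=
  Finset.sum_pair huw.symm

variable [Fintype V]

lemma sq_le_of_perron (hx1 : ∀ a, x a ≤ 1)
    (hx : ∀ a, ∑ b, adjVal G a b * x b = ρ * x a) (hm : ∑ a, ∑ b, adjVal G a b = 2 * m)
    {u : V} (hu : x u = 1) : ρ ^ 2 ≤ 2 * m := by
  have h := sum_sum_nbrCount_mul hx {u}
  rw [Finset.sum_singleton, hu, mul_one] at h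
  rw [← h, ← hm]
  refine Finset.sum_le_sum fun a _ => Finset.sum_le_sum fun b _ => ?_
  rw [nbrCount_singleton]
  refine mul_le_of_le_one_right (adjVal_nonneg _ _ _) ?_
  have h1 := hx1 b
  have h2 := adjVal_le_one G a u
  have h3 := adjVal_nonneg G a u
  nlinarith

/-- The common neighbours of `u` and `w`. -/
noncomputable def commonNbrs (G : SimpleGraph V) (u w : V) : Finset V :=
  open Classical in Finset.univ.filter fun a => G.Adj u a ∧ G.Adj w a

lemma mem_commonNbrs {u w a : V} : a ∈ commonNbrs G u w ↔ G.Adj u a ∧ G.Adj w a := by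
  simp [commonNbrs]

variable [DecidableEq V]

lemma sq_le_of_cutSize_le_two (hG : TwoCutEdges G) (hx0 : ∀ a, 0 ≤ x a) (hx1 : ∀ a, x a ≤ 1)
    (hx : ∀ a, ∑ b, adjVal G a b * x b = ρ * x a) (hρ : 0 ≤ ρ) {S : Finset V}
    (hS : cutSize G S ≤ 2) {z : V} (hz : z ∈ S) (hz4 : 1 / 4 ≤ x z)
    (hmax : ∀ a ∈ S, x a ≤ x z) :
    ρ ^ 2 ≤ (∑ a ∈ S, ∑ b ∈ S, adjVal G a b) / 2 + 10 * ρ + 8 := by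
  have h1 := walk_bound hG hx0 hx (L := {z})
    (by
      intro c hc c' hc'
      rw [Finset.mem_singleton.1 hc, Finset.mem_singleton.1 hc']
      exact fun _ _ => Iff.rfl)
    (fun a b => if a ∈ S ∧ b ∈ S then x z / 2 else adjVal G a z * x b)
    (by
      intro a b _
      simp only [nbrCount_singleton]
      have := hx0 a
      have := hx0 b
      have := hx0 z
      by_cases h : a ∈ S ∧ b ∈ S
      · rw [if_pos h, if_pos h.symm]
        have := hmax a h.1
        have := hmax b h.2
        by_cases h1 : G.Adj a z <;> by_cases h2 : G.Adj b z <;>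
          simp only [h1, h2, adjVal_of_adj, adjVal_of_not_adj, not_false_iff] <;> linarith
      · rw [if_neg h, if_neg (fun h' => h h'.symm)]
        have : 0 ≤ adjVal G a z * adjVal G b z * (x a + x b) :=
          mul_nonneg (mul_nonneg (adjVal_nonneg _ _ _) (adjVal_nonneg _ _ _)) (by linarith)
        linarith)
  have hSz : ∑ a ∈ Sᶜ, adjVal G a z ≤ 2 := by
    refine le_trans (le_of_eq ?_) ((sum_adjVal_le_cutSize hz).trans hS)
    exact Finset.sum_congr rfl fun a _ => adjVal_comm _ _ _
  have h2 : ∑ a, ∑ b, adjVal G a b * (if a ∈ S ∧ b ∈ S then x z / 2 else adjVal G a z * x b) ≤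
      x z / 2 * (∑ a ∈ S, ∑ b ∈ S, adjVal G a b) + 2 + 2 * ρ := by
    rw [← Finset.sum_add_sum_compl S]
    refine add_le_add ?_ ?_
    · calc _ ≤ ∑ a ∈ S, (x z / 2 * (∑ b ∈ S, adjVal G a b) + ∑ b ∈ Sᶜ, adjVal G a b) := by
            refine Finset.sum_le_sum fun a ha => ?_
            rw [← Finset.sum_add_sum_compl S, Finset.mul_sum]
            refine add_le_add (Finset.sum_le_sum fun b hb => ?_)
              (Finset.sum_le_sum fun b hb => ?_)
            · rw [if_pos ⟨ha, hb⟩, mul_comm]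
            · rw [if_neg (fun h => Finset.mem_compl.1 hb h.2)]
              exact mul_le_of_le_one_right (adjVal_nonneg _ _ _)
                (mul_le_one₀ (adjVal_le_one _ _ _) (hx0 b) (hx1 b))
        _ ≤ _ := by
            rw [Finset.sum_add_distrib, ← Finset.mul_sum]
            exact add_le_add le_rfl hS
    · calc _ = ∑ a ∈ Sᶜ, adjVal G a z * (ρ * x a) := by
            refine Finset.sum_congr rfl fun a ha => ?_
            rw [← hx a, Finset.mul_sum]
            refine Finset.sum_congr rfl fun b _ => ?_
            rw [if_neg (fun h => Finset.mem_compl.1 ha h.1)]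
            ring
        _ ≤ ∑ a ∈ Sᶜ, adjVal G a z * ρ := by
            refine Finset.sum_le_sum fun a _ => ?_
            exact mul_le_mul_of_nonneg_left (mul_le_of_le_one_right hρ (hx1 a))
              (adjVal_nonneg _ _ _)
        _ ≤ 2 * ρ := by
            rw [← Finset.sum_mul]
            exact mul_le_mul_of_nonneg_right hSz hρ
  rw [Finset.sum_singleton, Finset.card_singleton] at h1
  push_cast at h1
  set E := ∑ a ∈ S, ∑ b ∈ S, adjVal G a b
  have h3 : x z * (ρ ^ 2 - E / 2 - 2 * ρ) ≤ 2 + 2 * ρ := by linarith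
  by_contra! hcon
  have h4 : 0 < ρ ^ 2 - E / 2 - 2 * ρ := by linarith
  nlinarith

lemma twoCutEquiv_of_le (hG : TwoCutEdges G) (hx0 : ∀ a, 0 ≤ x a) (hx1 : ∀ a, x a ≤ 1)
    (hx : ∀ a, ∑ b, adjVal G a b * x b = ρ * x a) (hρ : 0 ≤ ρ)
    (hm : ∑ a, ∑ b, adjVal G a b = 2 * m) (hlt : m + 20 * ρ + 16 < 2 * ρ ^ 2) {a b : V}
    (ha : 1 / 4 ≤ x a) (hb : 1 / 4 ≤ x b) : TwoCutEquiv G a b := by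
  have key : ∀ (S : Finset V) (a b : V), 1 / 4 ≤ x a → 1 / 4 ≤ x b → cutSize G S ≤ 2 →
      a ∈ S → b ∉ S → False := by
    intro S a b ha hb hS haS hbS
    obtain ⟨a', ha'S, ha'⟩ := S.exists_max_image x ⟨a, haS⟩
    obtain ⟨b', hb'S, hb'⟩ := Sᶜ.exists_max_image x ⟨b, Finset.mem_compl.2 hbS⟩
    have h1 := sq_le_of_cutSize_le_two hG hx0 hx1 hx hρ hS ha'S (ha.trans (ha' a haS)) ha'
    have h2 := sq_le_of_cutSize_le_two hG hx0 hx1 hx hρ (by rwa [cutSize_compl]) hb'S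
      (hb.trans (hb' b (Finset.mem_compl.2 hbS))) hb'
    have h3 : ∑ a ∈ S, ∑ b ∈ S, adjVal G a b + ∑ a ∈ Sᶜ, ∑ b ∈ Sᶜ, adjVal G a b ≤ 2 * m := by
      rw [← hm, ← Finset.sum_add_sum_compl S]
      refine add_le_add (Finset.sum_le_sum fun a _ => ?_) (Finset.sum_le_sum fun a _ => ?_) <;>
      exact Finset.sum_le_sum_of_subset_of_nonneg (Finset.subset_univ _)
        (fun _ _ _ => adjVal_nonneg _ _ _)
    linarith
  intro S hS
  constructor
  · intro haS
    by_contra hbS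
    exact key S a b ha hb hS haS hbS
  · intro hbS
    by_contra haS
    exact key S b a hb ha hS hbS haS

lemma exists_second_large (hG : TwoCutEdges G) (hx0 : ∀ a, 0 ≤ x a)
    (hx : ∀ a, ∑ b, adjVal G a b * x b = ρ * x a)
    (hm : ∑ a, ∑ b, adjVal G a b = 2 * m) {u : V} (hu : x u = 1)
    (hlt : 7 / 8 * m + (∑ b, adjVal G u b) / 8 + 2 * ρ < ρ ^ 2) :
    ∃ w ≠ u, 7 / 8 < x w := by
  by_contra! hcon
  have h1 := walk_bound hG hx0 hx (L := {u})
    (by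
      intro c hc c' hc'
      rw [Finset.mem_singleton.1 hc, Finset.mem_singleton.1 hc']
      exact fun _ _ => Iff.rfl)
    (fun a b => 7 / 16 + if a = u then 1 / 8 else 0)
    (by
      intro a b hab
      simp only [nbrCount_singleton]
      have ha := hx0 a
      have hb := hx0 b
      by_cases hau : a = u
      · subst hau
        have hba : b ≠ a := hab.ne'
        rw [if_pos rfl, if_neg hba, adjVal_of_not_adj (G.irrefl (v := a)),
          adjVal_of_adj hab.symm, hu]
        linarith
      · by_cases hbu : b = u
        · subst hbu
          rw [if_neg hau, if_pos rfl, adjVal_of_not_adj (G.irrefl (v := b)),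
            adjVal_of_adj hab, hu]
          linarith
        · have := hcon a hau
          have := hcon b hbu
          rw [if_neg hau, if_neg hbu]
          by_cases h1 : G.Adj a u <;> by_cases h2 : G.Adj b u <;>
            simp only [h1, h2, adjVal_of_adj, adjVal_of_not_adj, not_false_iff] <;> linarith)
  have h2 : ∑ a, ∑ b, adjVal G a b * ((7 : ℝ) / 16 + if a = u then 1 / 8 else 0) =
      7 / 16 * (2 * m) + (∑ b, adjVal G u b) / 8 := by
    simp_rw [← Finset.sum_mul, mul_add, Finset.sum_add_distrib, ← Finset.sum_mul, mul_ite,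
      mul_zero]
    rw [Finset.sum_ite_eq' Finset.univ u, hm, if_pos (Finset.mem_univ u)]
    ring
  rw [h2, Finset.sum_singleton, Finset.card_singleton, hu] at h1
  push_cast at h1
  linarith

lemma lt_quarter_of_ne (hG : TwoCutEdges G) (hx0 : ∀ a, 0 ≤ x a) (hx1 : ∀ a, x a ≤ 1)
    (hx : ∀ a, ∑ b, adjVal G a b * x b = ρ * x a)
    (hm : ∑ a, ∑ b, adjVal G a b = 2 * m)
    (hequiv : ∀ a b, 1 / 4 ≤ x a → 1 / 4 ≤ x b → TwoCutEquiv G a b)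
    (hlt : 2 * m < 17 / 8 * (ρ ^ 2 - 6 * ρ)) {u w : V} (hu : x u = 1) (hw : 7 / 8 < x w)
    (huw : w ≠ u) {z : V} (hzu : z ≠ u) (hzw : z ≠ w) : x z < 1 / 4 := by
  by_contra! hz
  have hL4 : ∀ c ∈ ({u, w, z} : Finset V), 1 / 4 ≤ x c := by
    intro c hc
    simp only [Finset.mem_insert, Finset.mem_singleton] at hc
    rcases hc with rfl | rfl | rfl <;> linarith
  have hL : ∀ c ∈ ({u, w, z} : Finset V), ∀ c' ∈ ({u, w, z} : Finset V), TwoCutEquiv G c c' :=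
    fun c hc c' hc' => hequiv c c' (hL4 c hc) (hL4 c' hc')
  have h1 := walk_bound hG hx0 hx hL (fun _ _ => 1)
    (by
      intro a b _
      have ha := hx0 a
      have hb := hx0 b
      have ha1 := hx1 a
      have hb1 := hx1 b
      have ha2 := nbrCount_le_two hG hL a
      have hb2 := nbrCount_le_two hG hL b
      rcases nbrCount_eq_zero_or_one_le (G := G) {u, w, z} a with h | ⟨h, _⟩
      · rw [h]; nlinarith
      · rcases nbrCount_eq_zero_or_one_le (G := G) {u, w, z} b with h' | ⟨h', _⟩
        · rw [h']; nlinarith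
        · have e1 : 0 ≤ nbrCount G {u, w, z} a * x b * (nbrCount G {u, w, z} b - 1) :=
            mul_nonneg (mul_nonneg (by linarith) hb) (by linarith)
          have e2 : 0 ≤ nbrCount G {u, w, z} b * x a * (nbrCount G {u, w, z} a - 1) :=
            mul_nonneg (mul_nonneg (by linarith) ha) (by linarith)
          linarith)
  have hcard : ({u, w, z} : Finset V).card = 3 :=
    Finset.card_eq_three.2 ⟨u, w, z, huw.symm, hzu.symm, hzw.symm, rfl⟩
  have hsum : ∑ c ∈ ({u, w, z} : Finset V), x c = x u + (x w + x z) := by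
    rw [Finset.sum_insert (by simp [huw.symm, hzu.symm]), Finset.sum_pair hzw.symm]
  simp_rw [mul_one] at h1
  rw [hcard, hsum, hm, hu] at h1
  push_cast at h1
  have : 0 ≤ ρ ^ 2 - 6 * ρ := by
    have : 0 ≤ 2 * m := hm ▸ Finset.sum_nonneg fun _ _ => Finset.sum_nonneg fun _ _ =>
      adjVal_nonneg _ _ _
    linarith
  nlinarith

lemma sum_commonNbrs {u w : V} (huw : w ≠ u) (f : V → ℝ) :
    ∑ a, ∑ b, adjVal G a b * (if a ∈ commonNbrs G u w ∧ (b = u ∨ b = w) then f b else 0) =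
      (commonNbrs G u w).card * (f u + f w) := by
  have h : ∀ a, ∑ b, adjVal G a b * (if a ∈ commonNbrs G u w ∧ (b = u ∨ b = w) then f b else 0) =
      if a ∈ commonNbrs G u w then f u + f w else 0 := by
    intro a
    by_cases ha : a ∈ commonNbrs G u w
    · obtain ⟨hua, hwa⟩ := mem_commonNbrs.1 ha
      rw [if_pos ha, ← Finset.sum_pair huw.symm]
      symm
      refine Finset.sum_subset_zero_on_sdiff (Finset.subset_univ _) ?_ ?_
      · intro b hb
        simp only [Finset.mem_sdiff, Finset.mem_insert, Finset.mem_singleton] at hb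
        rw [if_neg (fun h => hb.2 h.2), mul_zero]
      · intro b hb
        simp only [Finset.mem_insert, Finset.mem_singleton] at hb
        rw [if_pos ⟨ha, hb⟩]
        rcases hb with rfl | rfl
        · rw [adjVal_of_adj hua.symm, one_mul]
        · rw [adjVal_of_adj hwa.symm, one_mul]
    · simp [ha]
  simp_rw [h]
  rw [Finset.sum_ite_mem, Finset.univ_inter, Finset.sum_const, nsmul_eq_mul]

/-- The pair `u, w` carries almost all of the weight of the Perron vector `x`. -/
structure IsCorePair (G : SimpleGraph V) (x : V → ℝ) (u w : V) : Prop where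
  nonneg : ∀ a, 0 ≤ x a
  ne : w ≠ u
  not_adj : ¬ G.Adj u w
  eq_one : x u = 1
  le_one : x w ≤ 1
  large : 7 / 8 < x w
  small : ∀ z, z ≠ u → z ≠ w → x z < 1 / 4

/-- The core edges join `u` or `w` to their common neighbours, read here from the common
neighbour `a`. -/
noncomputable def coreVal (G : SimpleGraph V) (u w a b : V) (t : ℝ) : ℝ :=
  if a ∈ commonNbrs G u w ∧ (b = u ∨ b = w) then t else 0

lemma coreVal_of_not_mem {u w a b : V} (h : a ∉ commonNbrs G u w) (t : ℝ) :
    coreVal G u w a b t = 0 :=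
  if_neg fun h' => h h'.1

lemma coreVal_of_ne {u w a b : V} (hu : b ≠ u) (hw : b ≠ w) (t : ℝ) :
    coreVal G u w a b t = 0 :=
  if_neg fun h => h.2.elim hu hw

lemma IsCorePair.edge_eq_of_left {u w b : V} (h : IsCorePair G x u w) (hab : G.Adj u b) :
    nbrCount G {u, w} u * x b + nbrCount G {u, w} b * x u =
      1 + (coreVal G u w u b (2 * x b - 1) + coreVal G u w b u (2 * x u - 1)) := by
  have h0 : nbrCount G {u, w} u = 0 := by
    rw [nbrCount_pair h.ne, adjVal_of_not_adj (G.irrefl (v := u)), adjVal_of_not_adj h.not_adj,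
      zero_add]
  rw [h0, coreVal_of_not_mem (fun h' => G.irrefl (mem_commonNbrs.1 h').1), nbrCount_pair h.ne,
    h.eq_one, adjVal_of_adj hab.symm]
  by_cases hb : G.Adj w b
  · rw [adjVal_of_adj hb.symm, coreVal, if_pos ⟨mem_commonNbrs.2 ⟨hab, hb⟩, Or.inl rfl⟩]
    ring
  · rw [adjVal_of_not_adj (fun h' => hb h'.symm),
      coreVal_of_not_mem (fun h' => hb (mem_commonNbrs.1 h').2)]
    ring

lemma IsCorePair.edge_le_of_right {u w b : V} (h : IsCorePair G x u w) (hab : G.Adj w b) :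
    nbrCount G {u, w} w * x b + nbrCount G {u, w} b * x w ≤
      1 + (coreVal G u w w b (2 * x b - 1) + coreVal G u w b w (2 * x w - 1)) := by
  have h0 : nbrCount G {u, w} w = 0 := by
    rw [nbrCount_pair h.ne, adjVal_of_not_adj (G.irrefl (v := w)),
      adjVal_of_not_adj (fun h' => h.not_adj h'.symm), zero_add]
  rw [h0, coreVal_of_not_mem (fun h' => G.irrefl (mem_commonNbrs.1 h').2), nbrCount_pair h.ne,
    adjVal_of_adj hab.symm]
  by_cases hb : G.Adj u b
  · rw [adjVal_of_adj hb.symm, coreVal, if_pos ⟨mem_commonNbrs.2 ⟨hb, hab⟩, Or.inr rfl⟩]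
    linarith
  · rw [adjVal_of_not_adj (fun h' => hb h'.symm),
      coreVal_of_not_mem (fun h' => hb (mem_commonNbrs.1 h').1)]
    linarith [h.le_one]

lemma IsCorePair.edge_lt {u w a b : V} (h : IsCorePair G x u w) (hau : a ≠ u) (hbu : b ≠ u)
    (haw : a ≠ w) (hbw : b ≠ w) :
    nbrCount G {u, w} a * x b + nbrCount G {u, w} b * x a <
      1 + (coreVal G u w a b (2 * x b - 1) + coreVal G u w b a (2 * x a - 1)) := by
  have key : ∀ a b, b ≠ u → b ≠ w → nbrCount G {u, w} a * x b < 1 / 2 := by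
    intro a b hbu hbw
    have h1 := h.small b hbu hbw
    have h2 := h.nonneg b
    have h3 := adjVal_le_one G a u
    have h4 := adjVal_le_one G a w
    rw [nbrCount_pair h.ne]
    nlinarith
  rw [coreVal_of_ne hbu hbw, coreVal_of_ne hau haw]
  linarith [key a b hbu hbw, key b a hau haw]

lemma IsCorePair.edge_le {u w a b : V} (h : IsCorePair G x u w) (hab : G.Adj a b) :
    nbrCount G {u, w} a * x b + nbrCount G {u, w} b * x a ≤
      1 + (coreVal G u w a b (2 * x b - 1) + coreVal G u w b a (2 * x a - 1)) := by
  by_cases hau : a = u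
  · subst hau
    exact (h.edge_eq_of_left hab).le
  by_cases hbu : b = u
  · subst hbu
    linarith [h.edge_eq_of_left hab.symm]
  by_cases haw : a = w
  · subst haw
    exact h.edge_le_of_right hab
  by_cases hbw : b = w
  · subst hbw
    linarith [h.edge_le_of_right hab.symm]
  exact (h.edge_lt hau hbu haw hbw).le

lemma IsCorePair.sum_bound {u w : V} (h : IsCorePair G x u w)
    (hm : ∑ a, ∑ b, adjVal G a b = 2 * m) :
    ∑ a, ∑ b, adjVal G a b *
      ((1 / 2 + coreVal G u w a b (2 * x b - 1)) + (1 / 2 + coreVal G u w b a (2 * x a - 1))) =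
      2 * (m + 2 * (commonNbrs G u w).card * x w) := by
  rw [sum_sum_symm (fun a b => 1 / 2 + coreVal G u w a b (2 * x b - 1))]
  simp_rw [mul_add, Finset.sum_add_distrib, ← Finset.sum_mul]
  have := sum_commonNbrs (G := G) h.ne fun b => 2 * x b - 1
  simp only [coreVal]
  rw [this, hm, h.eq_one]
  ring

lemma IsCorePair.card_ge {u w : V} (h : IsCorePair G x u w) (hG : TwoCutEdges G)
    (hx : ∀ a, ∑ b, adjVal G a b * x b = ρ * x a)
    (hm : ∑ a, ∑ b, adjVal G a b = 2 * m) (hequiv : TwoCutEquiv G u w)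
    (hlt : 0 ≤ ρ ^ 2 - 4 * ρ) :
    15 / 8 * (ρ ^ 2 - 4 * ρ) ≤ m + 2 * (commonNbrs G u w).card := by
  have hL : ∀ c ∈ ({u, w} : Finset V), ∀ c' ∈ ({u, w} : Finset V), TwoCutEquiv G c c' := by
    intro c hc c' hc'
    simp only [Finset.mem_insert, Finset.mem_singleton] at hc hc'
    rcases hc with rfl | rfl <;> rcases hc' with rfl | rfl
    exacts [fun _ _ => Iff.rfl, hequiv, hequiv.symm, fun _ _ => Iff.rfl]
  have h1 := walk_bound hG h.nonneg hx hL
    (fun a b => 1 / 2 + coreVal G u w a b (2 * x b - 1))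
    (by
      intro a b hab
      have h2 : 0 ≤ nbrCount G {u, w} a * nbrCount G {u, w} b * (x a + x b) :=
        mul_nonneg (mul_nonneg (nbrCount_nonneg _ _) (nbrCount_nonneg _ _))
          (add_nonneg (h.nonneg a) (h.nonneg b))
      linarith [h.edge_le hab])
  have h2 := h.sum_bound hm
  rw [sum_sum_symm (fun a b => 1 / 2 + coreVal G u w a b (2 * x b - 1))] at h2
  rw [Finset.sum_pair h.ne.symm, Finset.card_pair h.ne.symm, h.eq_one] at h1
  push_cast at h1
  have h3 : ((commonNbrs G u w).card : ℝ) * x w ≤ (commonNbrs G u w).card :=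
    mul_le_of_le_one_right (Nat.cast_nonneg _) h.le_one
  have h4 := mul_le_mul_of_nonneg_right h.large.le hlt
  linarith

/-- Two-walks ending in `{u, w}`. -/
lemma IsCorePair.sq_mul_le {u w : V} (h : IsCorePair G x u w)
    (hx : ∀ a, ∑ b, adjVal G a b * x b = ρ * x a)
    (hm : ∑ a, ∑ b, adjVal G a b = 2 * m) :
    ρ ^ 2 * (1 + x w) ≤ m + 2 * (commonNbrs G u w).card * x w ∧
      (ρ ^ 2 * (1 + x w) = m + 2 * (commonNbrs G u w).card * x w →
        ∀ a b, G.Adj a b → a = u ∨ b = u ∨ a = w ∨ b = w) := by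
  have h1 := sum_sum_nbrCount_mul hx {u, w}
  rw [Finset.sum_pair h.ne.symm, h.eq_one] at h1
  have h2 := h.sum_bound hm
  have h3 := sum_sum_symm (G := G) fun a b => nbrCount G {u, w} a * x b
  have h4 : ∀ a b, 0 ≤ adjVal G a b *
      (((1 / 2 + coreVal G u w a b (2 * x b - 1)) + (1 / 2 + coreVal G u w b a (2 * x a - 1))) -
        (nbrCount G {u, w} a * x b + nbrCount G {u, w} b * x a)) := by
    intro a b
    by_cases hab : G.Adj a b
    · rw [adjVal_of_adj hab]
      linarith [h.edge_le hab]
    · rw [adjVal_of_not_adj hab, zero_mul]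
  have h5 : ∑ a, ∑ b, adjVal G a b *
      (((1 / 2 + coreVal G u w a b (2 * x b - 1)) + (1 / 2 + coreVal G u w b a (2 * x a - 1))) -
        (nbrCount G {u, w} a * x b + nbrCount G {u, w} b * x a)) =
      2 * (m + 2 * (commonNbrs G u w).card * x w - ρ ^ 2 * (1 + x w)) := by
    simp_rw [mul_sub, Finset.sum_sub_distrib]
    rw [h2, h3, h1]
  have h6 : ∀ a, 0 ≤ ∑ b, adjVal G a b *
      (((1 / 2 + coreVal G u w a b (2 * x b - 1)) + (1 / 2 + coreVal G u w b a (2 * x a - 1))) -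
        (nbrCount G {u, w} a * x b + nbrCount G {u, w} b * x a)) :=
    fun a => Finset.sum_nonneg fun b _ => h4 a b
  refine ⟨by linarith [h5 ▸ Finset.sum_nonneg fun a (_ : a ∈ Finset.univ) => h6 a],
    fun heq a b hab => ?_⟩
  rw [heq, sub_self, mul_zero, Finset.sum_eq_zero_iff_of_nonneg fun a _ => h6 a] at h5
  have h7 := h5 a (Finset.mem_univ a)
  rw [Finset.sum_eq_zero_iff_of_nonneg fun b _ => h4 a b] at h7
  have h8 := h7 b (Finset.mem_univ b)
  rw [adjVal_of_adj hab] at h8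
  by_contra! hcon
  linarith [h.edge_lt (G := G) hcon.1 hcon.2.1 hcon.2.2.1 hcon.2.2.2]

/-- Two-walks ending in `w`. -/
lemma IsCorePair.card_mul_le_right {u w : V} (h : IsCorePair G x u w)
    (hx : ∀ a, ∑ b, adjVal G a b * x b = ρ * x a) :
    (commonNbrs G u w).card * (1 + x w) ≤ ρ ^ 2 * x w ∧
      ∀ v, G.Adj w v → ¬ G.Adj u v → (commonNbrs G u w).card * (1 + x w) < ρ ^ 2 * x w := by
  have h1 := sum_sum_nbrCount_mul hx {w}
  rw [Finset.sum_singleton] at h1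
  have h2 : ∀ a b, adjVal G a b * (if a ∈ commonNbrs G u w ∧ (b = u ∨ b = w) then x b else 0) ≤
      adjVal G a b * (nbrCount G {w} a * x b) := by
    intro a b
    refine mul_le_mul_of_nonneg_left ?_ (adjVal_nonneg _ _ _)
    split_ifs with ha
    · rw [nbrCount_singleton, adjVal_of_adj (mem_commonNbrs.1 ha.1).2.symm, one_mul]
    · exact mul_nonneg (nbrCount_nonneg _ _) (h.nonneg b)
  have h3 := sum_commonNbrs (G := G) h.ne x
  rw [h.eq_one] at h3
  rw [← h1, ← h3]
  refine ⟨Finset.sum_le_sum fun a _ => Finset.sum_le_sum fun b _ => h2 a b, fun v hwv huv => ?_⟩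
  refine Finset.sum_lt_sum (fun a _ => Finset.sum_le_sum fun b _ => h2 a b)
    ⟨v, Finset.mem_univ v, Finset.sum_lt_sum (fun b _ => h2 v b) ⟨w, Finset.mem_univ w, ?_⟩⟩
  rw [if_neg (fun h' => huv (mem_commonNbrs.1 h'.1).1), nbrCount_singleton,
    adjVal_of_adj hwv.symm]
  linarith [h.large]

end Structure

section Counting

variable {V : Type*} [DecidableEq V] {G : SimpleGraph V} {k m : ℕ}

lemma card_image_sym2_mk (u : V) (s : Finset V) : (s.image fun v => s(u, v)).card = s.card :=
  Finset.card_image_of_injective _ fun _ _ => Sym2.congr_right.1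

variable [Fintype V]

/-- The edges joining `u` or `w` to their common neighbours. -/
noncomputable def coreEdges (G : SimpleGraph V) (u w : V) : Finset (Sym2 V) :=
  (commonNbrs G u w).image (fun v => s(u, v)) ∪ (commonNbrs G u w).image (fun v => s(w, v))

lemma mem_coreEdges {u w : V} {e : Sym2 V} :
    e ∈ coreEdges G u w ↔ ∃ v, (G.Adj u v ∧ G.Adj w v) ∧ (e = s(u, v) ∨ e = s(w, v)) := by
  simp only [coreEdges, Finset.mem_union, Finset.mem_image, mem_commonNbrs]
  grind

lemma card_coreEdges {u w : V} (huw : w ≠ u) (hadj : ¬ G.Adj u w) :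
    (coreEdges G u w).card = 2 * (commonNbrs G u w).card := by
  rw [coreEdges, Finset.card_union_of_disjoint, card_image_sym2_mk, card_image_sym2_mk, two_mul]
  rw [Finset.disjoint_left]
  simp only [Finset.mem_image, mem_commonNbrs, not_exists, not_and]
  rintro _ ⟨a, ha, rfl⟩ b hb heq
  rcases Sym2.eq_iff.1 heq with ⟨h, _⟩ | ⟨rfl, _⟩
  · exact huw h
  · exact hadj ha.1

lemma coreEdges_subset {u w : V} : (coreEdges G u w : Set (Sym2 V)) ⊆ G.edgeSet := by
  intro e he
  obtain ⟨v, hv, rfl | rfl⟩ := mem_coreEdges.1 he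
  exacts [hv.1, hv.2]

lemma IsMinimallyKLEdgeConnected.card_commonNbrs_le (hG : IsMinimallyKLEdgeConnected k k G)
    (hm : G.edgeSet.ncard = m) {u w : V} (huw : w ≠ u) (hadj : ¬ G.Adj u w)
    (hC : 3 ≤ (commonNbrs G u w).card) : 2 * (commonNbrs G u w).card + k ≤ m + 2 := by
  obtain ⟨v, hv⟩ := Finset.card_pos.1 (show 0 < (commonNbrs G u w).card by omega)
  obtain ⟨huv, hwv⟩ := mem_commonNbrs.1 hv
  have hother : ∀ a, ∃ v', (G.Adj u v' ∧ G.Adj w v') ∧ v' ≠ v ∧ v' ≠ a := by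
    intro a
    have h1 : 0 < (commonNbrs G u w \ {v, a}).card := by
      have := Finset.le_card_sdiff {v, a} (commonNbrs G u w)
      have := Finset.card_le_two (a := v) (b := a)
      omega
    obtain ⟨v', hv'⟩ := Finset.card_pos.1 h1
    simp only [Finset.mem_sdiff, Finset.mem_insert, Finset.mem_singleton, not_or] at hv'
    exact ⟨v', mem_commonNbrs.1 hv'.1, hv'.2⟩
  have hc : (G.deleteEdges {s(u, v)}).Preconnected := by
    refine (hG.1.connected_delete_edge_of_not_isBridge ?_).preconnected
    rw [isBridge_iff, not_not]
    obtain ⟨a, ha, hav, -⟩ := hother v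
    have h1 : (G.deleteEdges {s(u, v)}).Adj u a := by
      rw [deleteEdges_adj]
      exact ⟨ha.1, by grind [G.ne_of_adj]⟩
    have h2 : (G.deleteEdges {s(u, v)}).Adj a w := by
      rw [deleteEdges_adj]
      exact ⟨ha.2.symm, by grind [G.ne_of_adj]⟩
    have h3 : (G.deleteEdges {s(u, v)}).Adj w v := by
      rw [deleteEdges_adj]
      exact ⟨hwv, by grind [G.ne_of_adj]⟩
    exact h1.reachable.trans (h2.reachable.trans h3.reachable)
  obtain ⟨F, hFsub, hFk, -, hF⟩ := hG.exists_bridges (G.mem_edgeSet.2 huv) hc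
  have hdisj : Disjoint (coreEdges G u w : Set (Sym2 V)) (F \ {s(w, v)}) := by
    rw [Set.disjoint_left]
    intro e he ⟨heF, hne⟩
    have hev : e ≠ s(u, v) := by
      have := hFsub heF
      rw [edgeSet_deleteEdges] at this
      exact this.2
    have hadj2 : ∀ a b, G.Adj a b → s(a, b) ≠ s(u, v) → s(a, b) ≠ e →
        ((G.deleteEdges {s(u, v)}).deleteEdges {e}).Adj a b := by
      intro a b hab h1 h2
      simp only [deleteEdges_adj, Set.mem_singleton_iff]
      exact ⟨⟨hab, h1⟩, h2⟩
    obtain ⟨a, ha, rfl | rfl⟩ := mem_coreEdges.1 he <;> obtain ⟨b, hb, hbv, hba⟩ := hother a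
    · refine hF u a heF ?_
      refine (hadj2 u b hb.1 ?_ ?_).reachable.trans ((hadj2 b w hb.2.symm ?_ ?_).reachable.trans
        (hadj2 w a ha.2 ?_ ?_).reachable) <;>
        simp [huw, hbv, hba, ha.1.ne, ha.2.ne, hb.1.ne', huv.ne, hwv.ne, ha.1.ne']
    · refine hF w a heF ?_
      have hav : a ≠ v := fun h => hne (h ▸ rfl)
      refine (hadj2 w b hb.2 ?_ ?_).reachable.trans ((hadj2 b u hb.1.symm ?_ ?_).reachable.trans
        (hadj2 u a ha.1 ?_ ?_).reachable) <;>
        simp [huw, huw.symm, hbv, hba, hav, ha.1.ne, ha.2.ne, hb.1.ne', hb.2.ne', huv.ne,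
          hwv.ne, ha.2.ne', ha.1.ne']
  have h1 : (F \ {s(w, v)}).ncard + 1 ≥ F.ncard := by
    have := Set.ncard_le_ncard_sdiff_add_ncard F {s(w, v)}
    rwa [Set.ncard_singleton] at this
  have h2 : (↑(coreEdges G u w) ∪ (F \ {s(w, v)}) : Set (Sym2 V)).ncard ≤ G.edgeSet.ncard := by
    refine Set.ncard_le_ncard (Set.union_subset coreEdges_subset ?_)
    intro e he
    exact edgeSet_mono (deleteEdges_le _) (hFsub he.1)
  rw [Set.ncard_union_eq hdisj, Set.ncard_coe_finset, card_coreEdges huw hadj] at h2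
  omega

lemma IsMinimallyKLEdgeConnected.sum_adjVal_le (hk : 2 ≤ k)
    (hG : IsMinimallyKLEdgeConnected k k G) (hm : G.edgeSet.ncard = m) (u : V) :
    3 * ∑ b, adjVal G u b ≤ 2 * m + k := by
  classical
  let T : Finset V := Finset.univ.filter fun a => ∀ b, G.Adj a b ↔ b = u
  have hT : (T.card : ℝ) + 2 ≤ k := by
    have := hG.ncard_leaves hk u T (by simp [T])
    rw [Set.ncard_coe_finset] at this
    exact_mod_cast this
  have h : ∀ a, (2 * adjVal G u a - if a ∈ T then 1 else 0) +
      (if a = u then ∑ b, adjVal G u b else 0) ≤ ∑ b, adjVal G a b := by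
    intro a
    by_cases hau : a = u
    · subst hau
      rw [adjVal_of_not_adj (G.irrefl (v := a)), if_pos rfl]
      split_ifs <;> linarith
    · rw [if_neg hau]
      have h0 : 0 ≤ ∑ b, adjVal G a b := Finset.sum_nonneg fun b _ => adjVal_nonneg _ _ _
      by_cases ha : G.Adj u a
      · have h1 : 1 ≤ ∑ b, adjVal G a b := by
          rw [← adjVal_of_adj ha.symm]
          exact Finset.single_le_sum (fun b _ => adjVal_nonneg G a b) (Finset.mem_univ u)
        rw [adjVal_of_adj ha]
        by_cases haT : a ∈ T
        · rw [if_pos haT]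
          linarith
        · obtain ⟨b, hab, hbu⟩ : ∃ b, G.Adj a b ∧ b ≠ u := by
            by_contra! hcon
            refine haT ?_
            simp only [T, Finset.mem_filter, Finset.mem_univ, true_and]
            exact fun b => ⟨hcon b, fun h => h ▸ ha.symm⟩
          have h2 : ∑ c ∈ {b, u}, adjVal G a c ≤ ∑ c, adjVal G a c :=
            Finset.sum_le_sum_of_subset_of_nonneg (Finset.subset_univ _)
              (fun c _ _ => adjVal_nonneg G a c)
          rw [Finset.sum_pair hbu, adjVal_of_adj hab, adjVal_of_adj ha.symm] at h2
          rw [if_neg haT]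
          linarith
      · rw [adjVal_of_not_adj ha]
        split_ifs <;> linarith
  have h2 := Finset.sum_le_sum fun a (_ : a ∈ Finset.univ) => h a
  rw [sum_adjVal m hm, Finset.sum_add_distrib, Finset.sum_sub_distrib, ← Finset.mul_sum,
    Finset.sum_ite_eq' Finset.univ u, if_pos (Finset.mem_univ u), Finset.sum_ite_mem,
    Finset.univ_inter, Finset.sum_const, nsmul_eq_mul, mul_one] at h2
  linarith

end Counting

section Kbook

variable {p s : ℕ}

@[simp] lemma kbook_adj_hub_hub (a b : Unit ⊕ Unit) :
    ¬ (Kbook p s).Adj (Sum.inl a) (Sum.inl b) := by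
  rcases a with a | a <;> rcases b with b | b <;> simp [Kbook]

@[simp] lemma kbook_adj_rim_rim (a b : Fin s ⊕ Fin p) :
    ¬ (Kbook p s).Adj (Sum.inr a) (Sum.inr b) := by
  rcases a with a | a <;> rcases b with b | b <;> simp [Kbook]

@[simp] lemma kbook_adj_center (a : Unit) (b : Fin s ⊕ Fin p) :
    (Kbook p s).Adj (Sum.inl (Sum.inl a)) (Sum.inr b) := by
  simp [Kbook]

@[simp] lemma kbook_adj_center' (a : Unit) (b : Fin s ⊕ Fin p) :
    (Kbook p s).Adj (Sum.inr b) (Sum.inl (Sum.inl a)) :=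
  (kbook_adj_center a b).symm

@[simp] lemma kbook_adj_apex (a : Unit) (b : Fin s) :
    (Kbook p s).Adj (Sum.inl (Sum.inr a)) (Sum.inr (Sum.inl b)) := by
  simp [Kbook]

@[simp] lemma kbook_adj_apex' (a : Unit) (b : Fin s) :
    (Kbook p s).Adj (Sum.inr (Sum.inl b)) (Sum.inl (Sum.inr a)) :=
  (kbook_adj_apex a b).symm

@[simp] lemma kbook_adj_apex_pendant (a : Unit) (b : Fin p) :
    ¬ (Kbook p s).Adj (Sum.inl (Sum.inr a)) (Sum.inr (Sum.inr b)) := by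
  simp [Kbook]

@[simp] lemma kbook_adj_apex_pendant' (a : Unit) (b : Fin p) :
    ¬ (Kbook p s).Adj (Sum.inr (Sum.inr b)) (Sum.inl (Sum.inr a)) :=
  fun h => kbook_adj_apex_pendant a b h.symm

variable {V : Type*} {G : SimpleGraph V}

lemma adjVal_iso {W : Type*} {H : SimpleGraph W} (φ : G ≃g H) (a b : V) :
    adjVal G a b = adjVal H (φ a) (φ b) := by
  by_cases h : G.Adj a b
  · rw [adjVal_of_adj h, adjVal_of_adj (φ.map_adj_iff.2 h)]
  · rw [adjVal_of_not_adj h, adjVal_of_not_adj fun h' => h (φ.map_adj_iff.1 h')]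

variable [Fintype V] [DecidableEq V]

lemma nonempty_iso_kbook (hc : G.Connected) {u w : V} (huw : w ≠ u) (hadj : ¬ G.Adj u w)
    (hE : ∀ a b, G.Adj a b → a = u ∨ b = u ∨ a = w ∨ b = w)
    (hW : ∀ v, G.Adj w v → G.Adj u v) (hm : G.edgeSet.ncard = 2 * s + p)
    (hs : (commonNbrs G u w).card = s) : Nonempty (G ≃g Kbook p s) := by
  classical
  let P : Finset V := Finset.univ.filter fun a => G.Adj u a ∧ ¬ G.Adj w a
  have hP : ∀ a, a ∈ P ↔ G.Adj u a ∧ ¬ G.Adj w a := fun a => by simp [P]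
  have hdisj : Disjoint (coreEdges G u w) (P.image fun v => s(u, v)) := by
    rw [Finset.disjoint_left]
    intro e he he'
    obtain ⟨b, hb, rfl⟩ := Finset.mem_image.1 he'
    rw [hP] at hb
    obtain ⟨a, ha, h | h⟩ := mem_coreEdges.1 he
    · exact hb.2 (Sym2.congr_right.1 h ▸ ha.2)
    · rcases Sym2.eq_iff.1 h with ⟨h, _⟩ | ⟨_, rfl⟩
      · exact huw h.symm
      · exact hadj hb.1
  have hedge : G.edgeSet = (coreEdges G u w ∪ P.image fun v => s(u, v) : Finset (Sym2 V)) := by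
    have key : ∀ b, G.Adj u b → s(u, b) ∈ coreEdges G u w ∪ P.image fun v => s(u, v) := by
      intro b hb
      by_cases hwb : G.Adj w b
      · exact Finset.mem_union_left _ (mem_coreEdges.2 ⟨b, ⟨hb, hwb⟩, Or.inl rfl⟩)
      · exact Finset.mem_union_right _ (Finset.mem_image_of_mem _ ((hP b).2 ⟨hb, hwb⟩))
    have key' : ∀ b, G.Adj w b → s(w, b) ∈ coreEdges G u w ∪ P.image fun v => s(u, v) :=
      fun b hb => Finset.mem_union_left _ (mem_coreEdges.2 ⟨b, ⟨hW b hb, hb⟩, Or.inr rfl⟩)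
    refine Set.Subset.antisymm ?_ ?_
    · intro e
      induction e using Sym2.ind with
      | _ a b =>
      intro hab
      rw [mem_edgeSet] at hab
      rw [Finset.mem_coe]
      rcases hE a b hab with rfl | rfl | rfl | rfl
      · exact key b hab
      · rw [Sym2.eq_swap]
        exact key a hab.symm
      · exact key' b hab
      · rw [Sym2.eq_swap]
        exact key' a hab.symm
    · intro e he
      rcases Finset.mem_union.1 (Finset.mem_coe.1 he) with he | he
      · exact coreEdges_subset he
      · obtain ⟨b, hb, rfl⟩ := Finset.mem_image.1 he
        exact ((hP b).1 hb).1
  have hPcard : P.card = p := by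
    rw [hedge, Set.ncard_coe_finset, Finset.card_union_of_disjoint hdisj,
      card_coreEdges huw hadj, card_image_sym2_mk] at hm
    omega
  let eC := (Finset.equivFinOfCardEq hs).symm
  let eP := (Finset.equivFinOfCardEq hPcard).symm
  have hC : ∀ i, G.Adj u (eC i) ∧ G.Adj w (eC i) := fun i => mem_commonNbrs.1 (eC i).2
  have hP' : ∀ i, G.Adj u (eP i) ∧ ¬ G.Adj w (eP i) := fun i => (hP _).1 (eP i).2
  let f : KbookV p s → V :=
    Sum.elim (Sum.elim (fun _ => u) fun _ => w) (Sum.elim (fun i => eC i) fun i => eP i)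
  have hf : Function.Bijective f := by
    constructor
    · have huC : ∀ i, (eC i : V) ≠ u := fun i => (hC i).1.ne'
      have huP : ∀ i, (eP i : V) ≠ u := fun i => (hP' i).1.ne'
      have hwC : ∀ i, (eC i : V) ≠ w := fun i => (hC i).2.ne'
      have hwP : ∀ i, (eP i : V) ≠ w := fun i h => hadj (h ▸ (hP' i).1)
      have hCP : ∀ i j, (eC i : V) ≠ eP j := fun i j h => (hP' j).2 (h ▸ (hC i).2)
      refine (Function.Injective.sumElim ?_ ?_ ?_)
      · exact Function.Injective.sumElim (fun _ _ _ => rfl) (fun _ _ _ => rfl)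
          fun _ _ => huw.symm
      · exact Function.Injective.sumElim (Subtype.val_injective.comp eC.injective)
          (Subtype.val_injective.comp eP.injective) hCP
      · rintro (a | a) (b | b)
        exacts [(huC b).symm, (huP b).symm, (hwC b).symm, (hwP b).symm]
    · intro v
      by_cases hvu : v = u
      · exact ⟨Sum.inl (Sum.inl ()), hvu.symm⟩
      by_cases hvw : v = w
      · exact ⟨Sum.inl (Sum.inr ()), hvw.symm⟩
      have hv : G.Adj u v := by
        have : Nontrivial V := ⟨⟨w, u, huw⟩⟩
        obtain ⟨b, hb⟩ := hc.preconnected.exists_adj_of_nontrivial v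
        rcases hE v b hb with h | rfl | h | rfl
        exacts [absurd h hvu, hb.symm, absurd h hvw, hW v hb.symm]
      by_cases hwv : G.Adj w v
      · refine ⟨Sum.inr (Sum.inl (eC.symm ⟨v, mem_commonNbrs.2 ⟨hv, hwv⟩⟩)), ?_⟩
        simp [f]
      · refine ⟨Sum.inr (Sum.inr (eP.symm ⟨v, (hP v).2 ⟨hv, hwv⟩⟩)), ?_⟩
        simp [f]
  refine ⟨RelIso.symm ⟨Equiv.ofBijective f hf, ?_⟩⟩
  have hrim : ∀ a b : V, G.Adj u a → G.Adj u b → ¬ G.Adj a b := by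
    intro a b ha hb hab
    rcases hE a b hab with rfl | rfl | rfl | rfl
    exacts [G.irrefl ha, G.irrefl hb, hadj ha, hadj hb]
  intro a b
  rw [Equiv.ofBijective_apply, Equiv.ofBijective_apply]
  rcases a with (a | a) | (a | a) <;> rcases b with (b | b) | (b | b) <;>
    simp [f, hC, hP', hadj, G.adj_comm _ u, G.adj_comm _ w, hrim]

/-- An explicit eigenvector of `Kbook p s`. -/
lemma le_specRad_of_iso_kbook (φ : G ≃g Kbook p s) (hs : 0 < s) {ρ : ℝ} (hρ : 0 < ρ)
    (h : (ρ ^ 2) ^ 2 - (2 * s + p) * ρ ^ 2 + p * s = 0) : ρ ≤ specRad G := by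
  let x : KbookV p s → ℝ := Sum.elim (Sum.elim (fun _ => ρ ^ 2 - s) fun _ => s)
    (Sum.elim (fun _ => ρ) fun _ => (ρ ^ 2 - s) / ρ)
  have hx : ∀ a, ∑ b, adjVal (Kbook p s) a b * x b = ρ * x a := by
    intro a
    rw [Fintype.sum_sum_type, Fintype.sum_sum_type, Fintype.sum_sum_type]
    rcases a with (a | a) | (a | a)
    · simp [x, adjVal_of_adj, adjVal_of_not_adj]
      field_simp
      linarith
    · simp [x, adjVal_of_adj, adjVal_of_not_adj]
      ring
    · simp [x, adjVal_of_adj, adjVal_of_not_adj]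
      ring
    · simp [x, adjVal_of_adj, adjVal_of_not_adj]
      field_simp
  refine le_specRad (mem_spectrum_of_mulVec_eq (x := x ∘ φ) ?_ ?_)
  · intro h0
    have := congrFun h0 (φ.symm (Sum.inl (Sum.inr ())))
    simp [x, hs.ne'] at this
  · funext a
    have h1 := hx (φ a)
    rw [← Equiv.sum_comp φ.toEquiv] at h1
    refine Eq.trans (Finset.sum_congr rfl fun b _ => ?_) h1
    exact congrArg (· * x (φ b)) (adjVal_iso φ a b)

end Kbook

section Bound

lemma core_quadratic_le {t y s m p : ℝ} (hs : 0 < s) (hy : 0 < y) (hy1 : y ≤ 1)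
    (h1 : s * (1 + y) ≤ t * y) (h2 : t * (1 + y) ≤ m + 2 * s * y) (hp : 2 * s ≤ m - p)
    (hps : p < 2 * s) :
    t ^ 2 - m * t + p * (m - p) / 2 ≤ 0 ∧ (t ^ 2 - m * t + p * (m - p) / 2 = 0 →
      t * y = s * (1 + y) ∧ t * (1 + y) = m + 2 * s * y ∧ 2 * s = m - p) := by
  have hts : s ≤ t - s := by
    by_contra! hlt
    nlinarith
  have e1 : 0 ≤ (t * y - s * (1 + y)) * (t - 2 * s) :=
    mul_nonneg (by linarith) (by linarith)
  have e2 : 0 ≤ (m + 2 * s * y - t * (1 + y)) * (t - s) :=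
    mul_nonneg (by linarith) (by linarith)
  have e3 : 0 ≤ (m - p - 2 * s) * (2 * s - p) := mul_nonneg (by linarith) (by linarith)
  have key : t ^ 2 - m * t + p * (m - p) / 2 = -((t * y - s * (1 + y)) * (t - 2 * s)) -
      (m + 2 * s * y - t * (1 + y)) * (t - s) - (m - p - 2 * s) * (2 * s - p) / 2 := by
    ring
  refine ⟨by linarith, fun h0 => ?_⟩
  have f1 : (t * y - s * (1 + y)) * (t - 2 * s) = 0 := by linarith
  have f2 : (m + 2 * s * y - t * (1 + y)) * (t - s) = 0 := by linarith
  have f3 : (m - p - 2 * s) * (2 * s - p) = 0 := by linarith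
  refine ⟨?_, ?_, ?_⟩
  · rcases mul_eq_zero.1 f1 with h | h
    · linarith
    · nlinarith
  · rcases mul_eq_zero.1 f2 with h | h
    · linarith
    · linarith
  · rcases mul_eq_zero.1 f3 with h | h
    · linarith
    · linarith

/-- The extremal value `T`: its square is the larger root of `t² - m t + (k - 2)(m - k + 2) / 2`. -/
lemma extremal_value_spec {k m : ℝ} (hk : 2 ≤ k) (hkm : 2 * k ≤ m) {T : ℝ}
    (hT : T = Real.sqrt (2 * m + 2 * Real.sqrt (2 * k ^ 2 - 2 * k * m + m ^ 2
      - 8 * k + 4 * m + 8)) / 2) :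
    0 < T ∧ m - k ≤ T ^ 2 ∧
      (T ^ 2) ^ 2 - m * T ^ 2 + (k - 2) * (m - (k - 2)) / 2 = 0 ∧
      ∀ t, T ^ 2 ≤ t → t ^ 2 - m * t + (k - 2) * (m - (k - 2)) / 2 ≤ 0 → t = T ^ 2 := by
  set D := 2 * k ^ 2 - 2 * k * m + m ^ 2 - 8 * k + 4 * m + 8 with hD
  have hD1 : (m - 2 * k) ^ 2 ≤ D := by nlinarith
  have hS0 := Real.sqrt_nonneg D
  have hS : Real.sqrt D ^ 2 = D := Real.sq_sqrt ((sq_nonneg _).trans hD1)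
  have hS1 : m - 2 * k ≤ Real.sqrt D := Real.le_sqrt_of_sq_le hD1
  have hT2 : T ^ 2 = (m + Real.sqrt D) / 2 := by
    rw [hT, div_pow, Real.sq_sqrt (by linarith)]
    ring
  refine ⟨?_, by linarith, ?_, fun t ht h => ?_⟩
  · rw [hT]
    exact div_pos (Real.sqrt_pos.2 (by linarith)) two_pos
  · rw [hT2]
    linarith
  · rw [hT2] at ht ⊢
    nlinarith

variable {V : Type*} [Fintype V] [DecidableEq V] {G : SimpleGraph V} {k m : ℕ}

lemma IsMinimallyKLEdgeConnected.twoCutEdges (hG : IsMinimallyKLEdgeConnected k k G) :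
    TwoCutEdges G := by
  intro a b hab h
  obtain ⟨f, hf⟩ := hG.exists_not_reachable hab
  obtain ⟨S, ha, hb, hS⟩ := exists_cutSize_le_two_of_not_reachable hf
  exact hb ((h S hS).1 ha)

/-- If the spectral radius is large, then the graph has a core pair carrying most edges. -/
lemma IsMinimallyKLEdgeConnected.exists_isCorePair (hk : 2 ≤ k)
    (hG : IsMinimallyKLEdgeConnected k k G) (hsize : G.edgeSet.ncard = m)
    (hm : (432 * k) ^ 2 ≤ m) (h0 : 0 ≤ specRad G) (hρ : (m : ℝ) - k ≤ specRad G ^ 2) :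
    ∃ (x : V → ℝ) (u w : V), (∀ a, ∑ b, adjVal G a b * x b = specRad G * x a) ∧
      IsCorePair G x u w ∧ (m : ℝ) / 2 ≤ 2 * (commonNbrs G u w).card := by
  have : Nonempty V := hG.1.nonempty
  obtain ⟨x, hx0, hx1, ⟨u, hu⟩, hx⟩ := exists_perron_vector G
  have hcut := hG.twoCutEdges
  have hsum := sum_adjVal m hsize
  have hsq := sq_le_of_perron hx1 hx hsum hu
  have hdeg := hG.sum_adjVal_le hk hsize u
  set ρ := specRad G
  have hK : (2 : ℝ) ≤ k := by exact_mod_cast hk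
  have hM : (432 * (k : ℝ)) ^ 2 ≤ m := by exact_mod_cast hm
  have hkm : (k : ℝ) ≤ m / 100000 := by nlinarith
  have hm0 : (746496 : ℝ) ≤ m := by nlinarith
  have hρm : ρ ≤ m / 600 := abs_le_of_sq_le_sq' (by nlinarith) (by linarith) |>.2
  have hequiv : ∀ a b, 1 / 4 ≤ x a → 1 / 4 ≤ x b → TwoCutEquiv G a b := fun a b ha hb =>
    twoCutEquiv_of_le hcut hx0 hx1 hx h0 hsum (by linarith) ha hb
  obtain ⟨w, hwu, hw⟩ := exists_second_large hcut hx0 hx hsum hu (by linarith)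
  have huw := hequiv u w (by linarith) (by linarith)
  have hcore : IsCorePair G x u w := ⟨hx0, hwu, fun h => hcut u w h huw, hu, hx1 w, hw,
    fun z hzu hzw => lt_quarter_of_ne hcut hx0 hx1 hx hsum hequiv (by linarith) hu hw hwu hzu hzw⟩
  have := hcore.card_ge hcut hx hsum huw (by linarith)
  exact ⟨x, u, w, hx, hcore, by linarith⟩

lemma IsMinimallyKLEdgeConnected.specRad_eq_of_le (hk : 2 ≤ k)
    (hG : IsMinimallyKLEdgeConnected k k G) (hsize : G.edgeSet.ncard = m)
    (hm : (432 * k) ^ 2 ≤ m) {T : ℝ}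
    (hT : T = Real.sqrt (2 * (m : ℝ) + 2 * Real.sqrt (2 * (k : ℝ) ^ 2 - 2 * (k : ℝ) * (m : ℝ)
      + (m : ℝ) ^ 2 - 8 * (k : ℝ) + 4 * (m : ℝ) + 8)) / 2) (hle : T ≤ specRad G) :
    specRad G = T ∧ Nonempty (G ≃g Kbook (k - 2) ((m - k + 2) / 2)) := by
  have hK : (2 : ℝ) ≤ k := by exact_mod_cast hk
  have hM : (432 * (k : ℝ)) ^ 2 ≤ m := by exact_mod_cast hm
  have hkm : (k : ℝ) ≤ m / 100000 := by nlinarith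
  obtain ⟨hT0, hT1, hT2, hT3⟩ := extremal_value_spec hK (by linarith) hT
  have hsq : T ^ 2 ≤ specRad G ^ 2 := pow_le_pow_left₀ hT0.le hle 2
  obtain ⟨x, u, w, hx, hcore, hC⟩ :=
    hG.exists_isCorePair hk hsize hm (hT0.le.trans hle) (hT1.trans hsq)
  have hsum := sum_adjVal m hsize
  set s := (commonNbrs G u w).card with hs
  have hs3 : 3 ≤ s := by
    have : (3 : ℝ) ≤ s := by linarith
    exact_mod_cast this
  have hsm : 2 * s + k ≤ m + 2 := hG.card_commonNbrs_le hsize hcore.ne hcore.not_adj hs3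
  have hsm' : 2 * (s : ℝ) + k ≤ m + 2 := by exact_mod_cast hsm
  obtain ⟨h1, h1'⟩ := hcore.sq_mul_le hx hsum
  obtain ⟨h2, h2'⟩ := hcore.card_mul_le_right hx
  obtain ⟨h3, h4⟩ := core_quadratic_le (by linarith) (by linarith [hcore.large]) hcore.le_one
    h2 h1 (p := (k : ℝ) - 2) (by linarith) (by linarith)
  have heq := hT3 _ hsq h3
  rw [heq, hT2] at h4
  obtain ⟨e1, e2, e3⟩ := h4 rfl
  rw [← heq] at e1 e2
  have hm2 : 2 * s + (k - 2) = m := by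
    have : 2 * s + k = m + 2 := by
      have : 2 * (s : ℝ) + k = m + 2 := by linarith
      exact_mod_cast this
    omega
  refine ⟨(pow_left_inj₀ (hT0.le.trans hle) hT0.le two_ne_zero).1 heq, ?_⟩
  refine nonempty_iso_kbook hG.1 hcore.ne hcore.not_adj (h1' e2) (fun v hv => ?_) ?_ ?_
  · by_contra huv
    exact (h2' v hv huv).ne e1.symm
  · omega
  · omega

end Bound

/-- Let `k ≥ 2` and let `G` be a minimally `(k,k)`-edge-connected graph of size
`m ≥ (432k)²`, where `m − k ≡ 0 (mod 2)`.  Then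
`ρ(G) ≤ √(2m + 2√(2k² − 2km + m² − 8k + 4m + 8)) / 2`, with equality if and only if
`G ≅ K^{k−2}_{2,(m−k+2)/2}`. -/
theorem spectral_radius_of_minimally_kk_edge_connected_size_even
    {V : Type*} [Fintype V] [DecidableEq V] (G : SimpleGraph V) (k m : ℕ)
    (hk : 2 ≤ k) (hsize : G.edgeSet.ncard = m) (hm : (432 * k) ^ 2 ≤ m)
    (hpar : (m - k) % 2 = 0)
    (hG : IsMinimallyKLEdgeConnected k k G) :
    specRad G ≤
      Real.sqrt (2 * (m : ℝ) +
        2 * Real.sqrt (2 * (k : ℝ) ^ 2 - 2 * (k : ℝ) * (m : ℝ) + (m : ℝ) ^ 2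
          - 8 * (k : ℝ) + 4 * (m : ℝ) + 8)) / 2 ∧
    (specRad G =
      Real.sqrt (2 * (m : ℝ) +
        2 * Real.sqrt (2 * (k : ℝ) ^ 2 - 2 * (k : ℝ) * (m : ℝ) + (m : ℝ) ^ 2
          - 8 * (k : ℝ) + 4 * (m : ℝ) + 8)) / 2 ↔
      Nonempty (G ≃g Kbook (k - 2) ((m - k + 2) / 2))) := by
  obtain ⟨T, hT⟩ : ∃ T, T = Real.sqrt (2 * (m : ℝ) +
      2 * Real.sqrt (2 * (k : ℝ) ^ 2 - 2 * (k : ℝ) * (m : ℝ) + (m : ℝ) ^ 2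
        - 8 * (k : ℝ) + 4 * (m : ℝ) + 8)) / 2 := ⟨_, rfl⟩
  rw [← hT]
  have key := hG.specRad_eq_of_le hk hsize hm hT
  have hle : specRad G ≤ T := by
    by_contra! h
    exact h.ne' (key h.le).1
  refine ⟨hle, fun h => (key h.ge).2, fun ⟨φ⟩ => hle.antisymm ?_⟩
  have hkm : 2 * k ≤ m := by nlinarith
  obtain ⟨hT0, -, hT2, -⟩ := extremal_value_spec (k := k) (m := m)
    (by exact_mod_cast hk) (by exact_mod_cast hkm) hT
  refine le_specRad_of_iso_kbook φ (by omega) hT0 ?_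
  have hp : ((k - 2 : ℕ) : ℝ) = k - 2 := by push_cast [hk]; rfl
  have hs : 2 * (((m - k + 2) / 2 : ℕ) : ℝ) + k = m + 2 := by
    have : 2 * ((m - k + 2) / 2) + k = m + 2 := by omega
    exact_mod_cast this
  rw [hp, ← hT2, show (m : ℝ) = 2 * (((m - k + 2) / 2 : ℕ) : ℝ) + k - 2 by linarith]
  ring
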